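/- arXiv:2211.15747 — 2 statements merged into one kernel-verified Lean document; each statement's English description precedes it below -/
import Mathlib

section
/- Let m be a positive integer and M, N ⊆ [m]. Then the number of pairs (v, w) ∈ Z_2^m × Z_2^m with v ≠ w, χ(v|M) = 0, χ(v|N) = 0, χ(w|M) = 0 and χ(v+w|M) = 1 equals {(2^{|M|} − 1)·2^{m−|M|} + (2^{|N|} − 1)·2^{m−|N|} − (2^{|M∪N|} − 1)·2^{m−|M∪N|}} · (2^{m−|M|} − 1). -/
open Polynomial
open scoped Classical

noncomputable section

/-- The ring `R = Z₂[u]/⟨u³ - u⟩`. -/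
abbrev Rng : Type := AdjoinRoot (X ^ 3 - X : Polynomial (ZMod 2))

/-- The image `u` of the variable in `R`. -/
def u : Rng := AdjoinRoot.root (X ^ 3 - X : Polynomial (ZMod 2))

/-- The natural inclusion of `Z₂` into `R`. -/
def toRng : ZMod 2 →+* Rng := AdjoinRoot.of _

lemma cubic_monic : (X ^ 3 - X : Polynomial (ZMod 2)).Monic :=
  Polynomial.monic_X_pow_sub (n := 3) (Polynomial.degree_X_le.trans_lt (by norm_num))

/-- The Gray map `Φ : R → Z₂³`, `Φ(a + u b + u² d) = (a + b, b + d, d)`: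
every element of `R` is represented by a unique polynomial of degree `< 3`,
whose coefficients are `a, b, d`. -/
def Phi (r : Rng) : Fin 3 → ZMod 2 :=
  ![(AdjoinRoot.modByMonicHom cubic_monic r).coeff 0 +
      (AdjoinRoot.modByMonicHom cubic_monic r).coeff 1,
    (AdjoinRoot.modByMonicHom cubic_monic r).coeff 1 +
      (AdjoinRoot.modByMonicHom cubic_monic r).coeff 2,
    (AdjoinRoot.modByMonicHom cubic_monic r).coeff 2]

/-- The support of a vector in `Z₂^m`. -/
def supp {m : ℕ} (v : Fin m → ZMod 2) : Finset (Fin m) :=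
  Finset.univ.filter (fun i => v i = 1)

/-- The simplicial complex `Δ_X` generated by `X ⊆ [m]`. -/
def Δ {m : ℕ} (X : Finset (Fin m)) : Finset (Fin m → ZMod 2) :=
  Finset.univ.filter (fun v => supp v ⊆ X)

/-- The Lee weight of a tuple over `R`: the Hamming weight of its coordinatewise Gray image. -/
def wtL {ι : Type} [Fintype ι] (x : ι → Rng) : ℕ :=
  ∑ i, (Finset.univ.filter (fun j : Fin 3 => Phi (x i) j ≠ 0)).card

/-- The defining set `D = (1+u²)D₁ + u²(D₂ + (u+u²)D₃) ⊆ R^m`. -/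
def Dset {m : ℕ} (D1 D2 D3 : Finset (Fin m → ZMod 2)) : Finset (Fin m → Rng) :=
  ((D1 ×ˢ D2) ×ˢ D3).image (fun t i =>
    (1 + u ^ 2) * toRng (t.1.1 i) +
      u ^ 2 * (toRng (t.1.2 i) + (u + u ^ 2) * toRng (t.2 i)))

/-- The codeword `c_D(v) = (v ⬝ d)_{d ∈ D}` of `C_D`. -/
def cD {m : ℕ} (D : Finset (Fin m → Rng)) (v : Fin m → Rng) : D → Rng :=
  fun d => ∑ i, v i * d.1 i


lemma disj_iff {m : ℕ} (v : Fin m → ZMod 2) (L : Finset (Fin m)) :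
    supp v ∩ L = ∅ ↔ ∀ i ∈ L, v i = 0 := by
  have h2 : ∀ a : ZMod 2, a = 0 ↔ a ≠ 1 := by decide
  rw [Finset.eq_empty_iff_forall_notMem]
  constructor
  · intro h i hi
    rw [h2]
    intro h1
    exact h i (by simp [supp, h1, hi])
  · intro h i hi
    simp only [supp, Finset.mem_inter, Finset.mem_filter, Finset.mem_univ, true_and] at hi
    exact (h2 _).1 (h i hi.2) hi.1

/-- Vectors vanishing on `L`. -/
def zeroOn {m : ℕ} (L : Finset (Fin m)) : Finset (Fin m → ZMod 2) :=
  Finset.univ.filter (fun v => ∀ i ∈ L, v i = 0)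

lemma mem_zeroOn {m : ℕ} (L : Finset (Fin m)) (v : Fin m → ZMod 2) :
    v ∈ zeroOn L ↔ ∀ i ∈ L, v i = 0 := by simp [zeroOn]

lemma card_zeroOn {m : ℕ} (L : Finset (Fin m)) : (zeroOn L).card = 2 ^ (m - L.card) := by
  have : zeroOn L = Fintype.piFinset
      (fun i => if i ∈ L then ({0} : Finset (ZMod 2)) else Finset.univ) := by
    ext v
    rw [mem_zeroOn, Fintype.mem_piFinset]
    refine forall_congr' fun i => ?_
    by_cases hi : i ∈ L <;> simp [hi]
  rw [this, Fintype.card_piFinset]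
  have h : ∀ i, (if i ∈ L then ({0} : Finset (ZMod 2)) else Finset.univ).card
      = if i ∈ L then 1 else 2 := by
    intro i
    by_cases hi : i ∈ L <;> simp [hi, ZMod.card]
  simp only [h]
  rw [Finset.prod_ite]
  simp only [Finset.prod_const_one, Finset.prod_const, one_mul]
  congr 1
  have : (Finset.univ.filter (fun i => i ∉ L)) = Lᶜ := by ext; simp
  rw [this, Finset.card_compl, Fintype.card_fin]

theorem count_pairs_chi_zero_sum_one (m : ℕ) (hm : 0 < m) (M N : Finset (Fin m)) :
    ((Finset.univ.filter (fun p : (Fin m → ZMod 2) × (Fin m → ZMod 2) =>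
        p.1 ≠ p.2 ∧ supp p.1 ∩ M ≠ ∅ ∧ supp p.1 ∩ N ≠ ∅ ∧ supp p.2 ∩ M ≠ ∅ ∧
          supp (p.1 + p.2) ∩ M = ∅)).card : ℤ) =
      ((2 ^ M.card - 1) * 2 ^ (m - M.card) + (2 ^ N.card - 1) * 2 ^ (m - N.card)
          - (2 ^ (M ∪ N).card - 1) * 2 ^ (m - (M ∪ N).card)) *
        (2 ^ (m - M.card) - 1) := by
  have hadd : ∀ a b : ZMod 2, a + (a + b) = b := by decide
  have haddv : ∀ a b : Fin m → ZMod 2, a + (a + b) = b := fun a b => funext fun i => hadd _ _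
  have hbij : (Finset.univ.filter (fun p : (Fin m → ZMod 2) × (Fin m → ZMod 2) =>
        p.1 ≠ p.2 ∧ supp p.1 ∩ M ≠ ∅ ∧ supp p.1 ∩ N ≠ ∅ ∧ supp p.2 ∩ M ≠ ∅ ∧
          supp (p.1 + p.2) ∩ M = ∅)).card =
      ((zeroOn M ∪ zeroOn N)ᶜ ×ˢ (zeroOn M).erase 0).card := by
    refine Finset.card_bij' (fun p _ => (p.1, p.1 + p.2)) (fun p _ => (p.1, p.1 + p.2))
      ?_ ?_ ?_ ?_
    · rintro ⟨v, w⟩ h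
      simp only [Finset.mem_filter, Finset.mem_univ, true_and, ne_eq, disj_iff] at h
      obtain ⟨h1, h2, h3, h4, h5⟩ := h
      simp only [Finset.mem_product, Finset.mem_compl, Finset.mem_union, mem_zeroOn,
        Finset.mem_erase]
      refine ⟨by tauto, ?_, h5⟩
      intro h0
      apply h1
      have := haddv v w
      rw [h0] at this
      simpa using this
    · rintro ⟨v, z⟩ h
      simp only [Finset.mem_product, Finset.mem_compl, Finset.mem_union, mem_zeroOn,
        Finset.mem_erase] at h
      obtain ⟨h1, h2, h3⟩ := h
      simp only [Finset.mem_filter, Finset.mem_univ, true_and, ne_eq, disj_iff, haddv]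
      refine ⟨?_, by tauto, by tauto, ?_, h3⟩
      · intro h0
        exact h2 (by simpa using h0)
      · intro h0
        apply h1
        left
        intro i hi
        have := h0 i hi
        simpa [h3 i hi] using this
    · rintro ⟨v, w⟩ h
      simp [haddv]
    · rintro ⟨v, w⟩ h
      simp [haddv]
  rw [hbij, Finset.card_product, Finset.card_erase_of_mem (by simp [mem_zeroOn]),
    Finset.card_compl, card_zeroOn]
  have hinter : zeroOn M ∩ zeroOn N = zeroOn (M ∪ N) := by
    ext v
    simp only [Finset.mem_inter, mem_zeroOn, Finset.mem_union]
    constructor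
    · rintro ⟨h1, h2⟩ i (hi | hi)
      exacts [h1 i hi, h2 i hi]
    · intro h
      exact ⟨fun i hi => h i (Or.inl hi), fun i hi => h i (Or.inr hi)⟩
  have hie := Finset.card_union_add_card_inter (zeroOn M) (zeroOn N)
  rw [hinter, card_zeroOn, card_zeroOn, card_zeroOn] at hie
  have hle : (zeroOn M ∪ zeroOn N).card ≤ Fintype.card (Fin m → ZMod 2) := Finset.card_le_univ _
  have hpow : ∀ L : Finset (Fin m), (2 : ℤ) ^ L.card * 2 ^ (m - L.card) = 2 ^ m := by
    intro L
    rw [← pow_add]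
    congr 1
    have := Finset.card_le_univ L
    rw [Fintype.card_fin] at this
    omega
  have hc : Fintype.card (Fin m → ZMod 2) = 2 ^ m := by simp [ZMod.card]
  rw [Nat.cast_mul, Nat.cast_sub hle, Nat.cast_sub Nat.one_le_two_pow, hc]
  have hie' : ((zeroOn M ∪ zeroOn N).card : ℤ) + 2 ^ (m - (M ∪ N).card)
      = 2 ^ (m - M.card) + 2 ^ (m - N.card) := by exact_mod_cast hie
  push_cast
  congr 1
  linear_combination -hie' - hpow M - hpow N + hpow (M ∪ N)
end
end

section
/- Let m be a positive integer and L, M, N ⊆ [m] with L ≠ [m]. Let D = (1+u^2)Δ_L^c + u^2(Δ_M + (u+u^2)Δ_N) ⊆ R^m. Then C_D has length |D| = (2^m − 2^{|L|})·2^{|M|+|N|} and |C_D| = 2^{m+|M|+|M∪N|}. Moreover, for every v ∈ R^m the Lee weight wt_L(c_D(v)) is one of the five values 0, 3·2^{m+|M|+|N|−1}, 2^{|M|+|N|−1}(3·2^m − 2^{|L|+1}), 3·(2^m − 2^{|L|})·2^{|M|+|N|−1}, (2^m − 2^{|L|})·2^{|M|+|N|}, and the numbers of v ∈ R^m attaining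 these values are, respectively: 2^{2m−|M|−|M∪N|}; (2^{m−|L|} − 1)·2^{2m−|M|−|M∪N|}; (2^{m−|L|} − 1)(2^{2m−|M|−|N|+1} + 2^{2m−|M|} − 3·2^{2m−|M|−|M∪N|}); 2^{3m} − 2^{3m−|L|−|M|} − 2^{3m−|L|−|M|−|N|+1} + 2^{3m−|L|−|M|−|M∪N|+1}; and 2^{2m−|M|−|N|+1} + 2^{2m−|M|} − 3·2^{2m−|M|−|M∪N|}. -/
open Polynomial
open scoped Classical

noncomputable section

abbrev Vec (m : ℕ) := Fin m → ZMod 2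

/-- Coordinates of `R` with respect to `1 + u²`, `u²`, `u + u²`. -/
def emb (a b c : ZMod 2) : Rng :=
  (1 + u ^ 2) * toRng a + u ^ 2 * toRng b + (u + u ^ 2) * toRng c

lemma u_cube : u ^ 3 = u := by
  have h : AdjoinRoot.mk (X ^ 3 - X : Polynomial (ZMod 2)) (X ^ 3 - X) = 0 := AdjoinRoot.mk_self
  rw [map_sub, map_pow, AdjoinRoot.mk_X] at h
  exact sub_eq_zero.mp h

lemma rng_two : (2 : Rng) = 0 := by
  have h : toRng (2 : ZMod 2) = 0 := by
    rw [show (2 : ZMod 2) = 0 from rfl, map_zero]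
  rwa [map_ofNat] at h

def embPoly (a b c : ZMod 2) : Polynomial (ZMod 2) :=
  C (a + b + c) * X ^ 2 + C c * X + C a

lemma emb_eq_mk (a b c : ZMod 2) :
    emb a b c = AdjoinRoot.mk (X ^ 3 - X : Polynomial (ZMod 2)) (embPoly a b c) := by
  unfold emb embPoly u toRng
  simp only [map_add, map_mul, map_pow, AdjoinRoot.mk_C, AdjoinRoot.mk_X]
  ring

lemma cubic_degree : (X ^ 3 - X : Polynomial (ZMod 2)).degree = 3 := by
  compute_degree!

lemma modBy_emb (a b c : ZMod 2) :
    AdjoinRoot.modByMonicHom cubic_monic (emb a b c) = embPoly a b c := by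
  rw [emb_eq_mk, AdjoinRoot.modByMonicHom_mk, modByMonic_eq_self_iff cubic_monic, cubic_degree]
  exact lt_of_le_of_lt degree_quadratic_le (by norm_num)

lemma quad_coeff (p q r : ZMod 2) :
    (C p * X ^ 2 + C q * X + C r : Polynomial (ZMod 2)).coeff 0 = r ∧
    (C p * X ^ 2 + C q * X + C r : Polynomial (ZMod 2)).coeff 1 = q ∧
    (C p * X ^ 2 + C q * X + C r : Polynomial (ZMod 2)).coeff 2 = p := by
  refine ⟨?_, ?_, ?_⟩ <;> simp [coeff_C, coeff_X, coeff_X_pow]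

lemma Phi_emb (a b c : ZMod 2) : Phi (emb a b c) = ![a + c, a + b, a + b + c] := by
  have h2 : ∀ x : ZMod 2, x + x = 0 := by decide
  unfold Phi
  rw [modBy_emb]
  obtain ⟨e0, e1, e2⟩ := quad_coeff (a + b + c) c a
  unfold embPoly
  rw [e0, e1, e2]
  have : c + (a + b + c) = a + b := by linear_combination h2 c
  rw [this]

lemma emb_inj {a b c a' b' c' : ZMod 2} (h : emb a b c = emb a' b' c') :
    a = a' ∧ b = b' ∧ c = c' := by
  have h' := congrArg Phi h
  rw [Phi_emb, Phi_emb] at h'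
  have h0 := congrFun h' 0
  have h1 := congrFun h' 1
  have h2 := congrFun h' 2
  simp at h0 h1 h2
  revert h0 h1 h2
  revert a b c a' b' c'
  intro a b c a' b' c' _ _ h0 h1 h2
  rw [h1] at h2
  have hc : c = c' := by simpa using h2
  subst hc
  have ha : a = a' := by simpa using h0
  subst ha
  exact ⟨rfl, by simpa using h1, rfl⟩

lemma emb_surj (r : Rng) : ∃ a b c, r = emb a b c := by
  set p := AdjoinRoot.modByMonicHom cubic_monic r with hp
  have hr : AdjoinRoot.mk _ p = r := AdjoinRoot.mk_leftInverse cubic_monic r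
  obtain ⟨q, hq⟩ := AdjoinRoot.mk_surjective r
  have hd : p.degree < 3 := by
    rw [hp, ← hq, AdjoinRoot.modByMonicHom_mk, ← cubic_degree]
    exact degree_modByMonic_lt _ cubic_monic
  have hpe : embPoly (p.coeff 0) (p.coeff 2 - p.coeff 0 - p.coeff 1) (p.coeff 1) = p := by
    unfold embPoly
    obtain ⟨e0, e1, e2⟩ := quad_coeff (p.coeff 0 + (p.coeff 2 - p.coeff 0 - p.coeff 1) + p.coeff 1)
      (p.coeff 1) (p.coeff 0)
    ext n
    rcases n with _ | _ | _ | n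
    · exact e0
    · exact e1
    · rw [e2]; ring
    · have h3 : (3 : WithBot ℕ) ≤ ((n + 1 + 1 + 1 : ℕ) : WithBot ℕ) := by
        exact_mod_cast (by omega : 3 ≤ n + 1 + 1 + 1)
      rw [coeff_eq_zero_of_degree_lt (p := p) (lt_of_lt_of_le hd h3),
        coeff_eq_zero_of_degree_lt (lt_of_lt_of_le (lt_of_le_of_lt degree_quadratic_le
          (by norm_num)) h3)]
  refine ⟨p.coeff 0, p.coeff 2 - p.coeff 0 - p.coeff 1, p.coeff 1, ?_⟩
  rw [emb_eq_mk, hpe, hr]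

lemma emb_mul (a b c a' b' c' : ZMod 2) :
    emb a b c * emb a' b' c' = emb (a * a') (b * b') (b * c' + c * b') := by
  unfold emb
  simp only [map_add, map_mul]
  have h3 := u_cube
  have h2 := rng_two
  generalize toRng a = A, toRng b = B, toRng c = C, toRng a' = A', toRng b' = B', toRng c' = C'
  linear_combination (A * A' + A * B' + B * A') * (u * h3 + u ^ 2 * h2)
    + (A * C' + C * A') * ((1 + u) * h3 + (u + u ^ 2) * h2)
    + B * B' * (u * h3) + (B * C' + C * B') * ((1 + u) * h3)
    + C * C' * (u * h3 + (u ^ 2 + u ^ 3) * h2)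

lemma emb_add (a b c a' b' c' : ZMod 2) :
    emb a b c + emb a' b' c' = emb (a + a') (b + b') (c + c') := by
  unfold emb
  simp only [map_add]
  ring

lemma emb_zero : emb 0 0 0 = 0 := by
  unfold emb; simp

lemma emb_sum {ι : Type} (s : Finset ι) (a b c : ι → ZMod 2) :
    ∑ i ∈ s, emb (a i) (b i) (c i) = emb (∑ i ∈ s, a i) (∑ i ∈ s, b i) (∑ i ∈ s, c i) := by
  induction s using Finset.induction_on with
  | empty => simp [emb_zero]
  | insert i s hi ih => simp only [Finset.sum_insert hi, ih, emb_add]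

/-- Coordinates on `R^m`. -/
def E (m : ℕ) : (Vec m × Vec m × Vec m) ≃ (Fin m → Rng) :=
  Equiv.ofBijective (fun t i => emb (t.1 i) (t.2.1 i) (t.2.2 i)) (by
    constructor
    · rintro ⟨a, b, c⟩ ⟨a', b', c'⟩ h
      have h' := fun i => emb_inj (congrFun h i)
      simp only [Prod.mk.injEq]
      exact ⟨funext fun i => (h' i).1, funext fun i => (h' i).2.1, funext fun i => (h' i).2.2⟩
    · intro v
      choose a b c h using fun i => emb_surj (v i)
      exact ⟨(a, b, c), funext fun i => (h i).symm⟩)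

lemma E_apply {m : ℕ} (t : Vec m × Vec m × Vec m) (i : Fin m) :
    E m t i = emb (t.1 i) (t.2.1 i) (t.2.2 i) := rfl

lemma E_dot {m : ℕ} (x t : Vec m × Vec m × Vec m) :
    ∑ i, E m x i * E m t i = emb (∑ i, x.1 i * t.1 i) (∑ i, x.2.1 i * t.2.1 i)
      ((∑ i, x.2.1 i * t.2.2 i) + ∑ i, x.2.2 i * t.2.1 i) := by
  simp only [E_apply, emb_mul, emb_sum, Finset.sum_add_distrib]

lemma Dset_eq {m : ℕ} (D1 D2 D3 : Finset (Vec m)) :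
    Dset D1 D2 D3 = (D1 ×ˢ D2 ×ˢ D3).map (E m).toEmbedding := by
  have key : ∀ a b c : ZMod 2, (1 + u ^ 2) * toRng a + u ^ 2 * (toRng b + (u + u ^ 2) * toRng c)
      = emb a b c := by
    intro a b c
    unfold emb
    linear_combination (1 + u) * toRng c * u_cube
  ext v
  simp only [Dset, key, Finset.mem_image, Finset.mem_map, Finset.mem_product, Prod.exists,
    Equiv.coe_toEmbedding]
  constructor
  · rintro ⟨a, b, c, ⟨⟨⟨h1, h2⟩, h3⟩, rfl⟩⟩
    exact ⟨a, b, c, ⟨h1, h2, h3⟩, rfl⟩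
  · rintro ⟨a, b, c, ⟨h1, h2, h3⟩, rfl⟩
    exact ⟨a, b, c, ⟨⟨h1, h2⟩, h3⟩, rfl⟩

lemma zmod2_cases (x : ZMod 2) : x = 0 ∨ x = 1 := by
  revert x; decide

/-- The sign character. -/
def chi (x : ZMod 2) : ℤ := if x = 0 then 1 else -1

lemma chi_add : ∀ x y : ZMod 2, chi (x + y) = chi x * chi y := by
  intro x y
  have h11 : (1 + 1 : ZMod 2) = 0 := by decide
  rcases zmod2_cases x with rfl | rfl <;> rcases zmod2_cases y with rfl | rfl <;>
    simp [chi, h11]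

lemma chi_zero : chi 0 = 1 := by simp [chi]

lemma chi_sum {ι : Type} (s : Finset ι) (f : ι → ZMod 2) :
    chi (∑ i ∈ s, f i) = ∏ i ∈ s, chi (f i) := by
  induction s using Finset.induction_on with
  | empty => simp [chi_zero]
  | insert i s hi ih => simp only [Finset.sum_insert hi, Finset.prod_insert hi, ih, chi_add]

/-- `a` vanishes on `X`. -/
def Van {m : ℕ} (X : Finset (Fin m)) (a : Vec m) : Prop := ∀ i ∈ X, a i = 0

lemma Δ_eq {m : ℕ} (X : Finset (Fin m)) :
    Δ X = Fintype.piFinset (fun i => if i ∈ X then Finset.univ else {0}) := by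
  ext v
  simp only [Δ, supp, Finset.mem_filter, Finset.mem_univ, true_and, Fintype.mem_piFinset,
    Finset.subset_iff]
  refine forall_congr' fun i => ?_
  by_cases hi : i ∈ X
  · simp [hi]
  · rcases zmod2_cases (v i) with h | h <;> simp [hi, h]

lemma card_Δ {m : ℕ} (X : Finset (Fin m)) : (Δ X).card = 2 ^ X.card := by
  rw [Δ_eq, Fintype.card_piFinset]
  have : ∀ i : Fin m, (if i ∈ X then (Finset.univ : Finset (ZMod 2)) else {0}).card
      = if i ∈ X then 2 else 1 := by
    intro i; split_ifs <;> simp [ZMod.card]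
  simp only [this, Finset.prod_ite, Finset.prod_const]
  simp

lemma chi_Δ {m : ℕ} (X : Finset (Fin m)) (a : Vec m) :
    ∑ t ∈ Δ X, chi (∑ i, a i * t i) = if Van X a then 2 ^ X.card else 0 := by
  simp only [chi_sum]
  rw [Δ_eq, ← Finset.prod_univ_sum (fun i => if i ∈ X then Finset.univ else {0})
    (fun i x => chi (a i * x))]
  have key : ∀ i : Fin m, ∑ x ∈ (if i ∈ X then (Finset.univ : Finset (ZMod 2)) else {0}),
      chi (a i * x) = if i ∈ X then (if a i = 0 then 2 else 0) else 1 := by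
    intro i
    by_cases hi : i ∈ X
    · have hu : (Finset.univ : Finset (ZMod 2)) = {0, 1} := rfl
      simp only [hi, if_true, hu]
      rw [Finset.sum_pair (by decide)]
      rcases zmod2_cases (a i) with h | h <;> simp [h, chi]
    · simp [hi, chi_zero]
  simp only [key]
  by_cases hv : Van X a
  · rw [if_pos hv]
    have : ∀ i : Fin m, (if i ∈ X then (if a i = 0 then (2:ℤ) else 0) else 1)
        = if i ∈ X then 2 else 1 := by
      intro i
      by_cases hi : i ∈ X
      · simp [hi, hv i hi]
      · simp [hi]
    simp only [this, Finset.prod_ite, Finset.prod_const]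
    simp
  · rw [if_neg hv]
    unfold Van at hv
    push Not at hv
    obtain ⟨i, hi, hai⟩ := hv
    exact Finset.prod_eq_zero (Finset.mem_univ i) (by simp [hi, hai])

lemma van_univ {m : ℕ} (a : Vec m) : Van Finset.univ a ↔ a = 0 := by
  simp [Van, funext_iff]

lemma Δ_univ {m : ℕ} : Δ (Finset.univ : Finset (Fin m)) = Finset.univ := by
  simp [Δ]

lemma card_van {m : ℕ} (X : Finset (Fin m)) :
    (Finset.univ.filter (fun a : Vec m => Van X a)).card = 2 ^ (m - X.card) := by
  have : Finset.univ.filter (fun a : Vec m => Van X a) = Δ Xᶜ := by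
    ext a
    rw [Finset.mem_filter]
    simp only [Δ, supp, Van, Finset.mem_filter, Finset.mem_univ, true_and, Finset.subset_iff,
      Finset.mem_compl]
    refine forall_congr' fun i => ?_
    rcases zmod2_cases (a i) with h | h <;> simp [h]
  rw [this, card_Δ, Finset.card_compl, Fintype.card_fin]

/-- Character sum over the first component. -/
def Aval {m : ℕ} (L : Finset (Fin m)) (a : Vec m) : ℤ :=
  (if a = 0 then 2 ^ m else 0) - (if Van L a then 2 ^ L.card else 0)

/-- Number of nontrivial contributions from the other components. -/
def Sval {m : ℕ} (M N : Finset (Fin m)) (b c : Vec m) : ℤ :=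
  (if Van M c ∧ Van N b then 1 else 0) + (if Van M b then 1 else 0) +
    (if Van M (b + c) ∧ Van N b then 1 else 0)

lemma chi_Δc {m : ℕ} (L : Finset (Fin m)) (a : Vec m) :
    ∑ t ∈ (Δ L)ᶜ, chi (∑ i, a i * t i) = Aval L a := by
  have h := Finset.sum_add_sum_compl (Δ L) (fun t => chi (∑ i, a i * t i))
  have h2 := chi_Δ (Finset.univ) a
  rw [Δ_univ] at h2
  rw [h2, chi_Δ] at h
  unfold Aval
  simp only [van_univ, Finset.card_univ, Fintype.card_fin] at h
  rw [← h]; ring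

lemma card_Phi (a b c : ZMod 2) :
    2 * (((Finset.univ.filter (fun j : Fin 3 => Phi (emb a b c) j ≠ 0)).card : ℕ) : ℤ)
      = 3 - (chi (a + c) + chi (a + b) + chi (a + b + c)) := by
  rw [Phi_emb, Finset.card_filter]
  have : ∀ x : ZMod 2, 2 * (((if x ≠ 0 then 1 else 0 : ℕ)) : ℤ) = 1 - chi x := by
    intro x
    rcases zmod2_cases x with h | h <;> simp [h, chi]
  push_cast
  rw [Finset.mul_sum, Fin.sum_univ_three]
  have h0 := this (a + c)
  have h1 := this (a + b)
  have h2 := this (a + b + c)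
  push_cast at h0 h1 h2
  have h : ∀ x y z : ℤ, (1 - x) + (1 - y) + (1 - z) = 3 - (x + y + z) := by intros; ring
  rw [← h, ← h0, ← h1, ← h2]
  rfl

lemma card_D {m : ℕ} (L M N : Finset (Fin m)) :
    ((Dset ((Δ L)ᶜ) (Δ M) (Δ N)).card : ℤ) = (2 ^ m - 2 ^ L.card) * 2 ^ (M.card + N.card) := by
  rw [Dset_eq, Finset.card_map, Finset.card_product, Finset.card_product, Finset.card_compl,
    card_Δ, card_Δ, card_Δ]
  have : (2:ℕ) ^ L.card ≤ 2 ^ m := Nat.pow_le_pow_right (by norm_num) (by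
    simpa using Finset.card_le_univ L)
  simp only [Fintype.card_pi, ZMod.card, Finset.prod_const, Finset.card_univ, Fintype.card_fin]
  push_cast [Nat.cast_sub this]
  ring

lemma wt_formula {m : ℕ} (L M N : Finset (Fin m)) (x : Vec m × Vec m × Vec m) :
    2 * (wtL (cD (Dset ((Δ L)ᶜ) (Δ M) (Δ N)) (E m x)) : ℤ)
      = 2 ^ (M.card + N.card) *
        (3 * (2 ^ m - 2 ^ L.card) - Aval L x.1 * Sval M N x.2.1 x.2.2) := by
  obtain ⟨a, b, c⟩ := x
  set D := Dset ((Δ L)ᶜ) (Δ M) (Δ N) with hD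
  have h1 : wtL (cD D (E m (a, b, c))) = ∑ d ∈ D,
      (Finset.univ.filter (fun j : Fin 3 => Phi (∑ i, E m (a, b, c) i * d i) j ≠ 0)).card := by
    unfold wtL cD
    exact Finset.sum_coe_sort D (fun d => (Finset.univ.filter
      (fun j : Fin 3 => Phi (∑ i, E m (a, b, c) i * d i) j ≠ 0)).card)
  have hcard := card_D L M N
  rw [← hD] at hcard
  rw [h1]
  push_cast
  rw [Finset.mul_sum]
  rw [hD, Dset_eq, Finset.card_map] at hcard
  rw [hD, Dset_eq, Finset.sum_map]
  simp only [Equiv.coe_toEmbedding, E_dot, card_Phi]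
  rw [Finset.sum_sub_distrib, Finset.sum_const, nsmul_eq_mul, hcard]
  simp only [Finset.sum_add_distrib]
  have hA := chi_Δc L a
  -- the three character sums
  have s1 : ∑ t ∈ (Δ L)ᶜ ×ˢ Δ M ×ˢ Δ N, chi (∑ i, a i * t.1 i +
      (∑ i, b i * t.2.2 i + ∑ i, c i * t.2.1 i)) =
      Aval L a * (2 ^ (M.card + N.card) * if Van M c ∧ Van N b then 1 else 0) := by
    simp only [chi_add, Finset.sum_product, ← Finset.mul_sum, ← Finset.sum_mul, hA, chi_Δ]
    by_cases h1 : Van M c <;> by_cases h2 : Van N b <;> simp [h1, h2, pow_add, mul_comm]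
  have s2 : ∑ t ∈ (Δ L)ᶜ ×ˢ Δ M ×ˢ Δ N, chi (∑ i, a i * t.1 i + ∑ i, b i * t.2.1 i) =
      Aval L a * (2 ^ (M.card + N.card) * if Van M b then 1 else 0) := by
    simp only [chi_add, Finset.sum_product, ← Finset.mul_sum, ← Finset.sum_mul, hA, chi_Δ,
      Finset.sum_const, card_Δ, nsmul_eq_mul]
    by_cases h1 : Van M b <;> simp [h1, pow_add, mul_comm]
  have s3 : ∑ t ∈ (Δ L)ᶜ ×ˢ Δ M ×ˢ Δ N, chi (∑ i, a i * t.1 i + ∑ i, b i * t.2.1 i +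
      (∑ i, b i * t.2.2 i + ∑ i, c i * t.2.1 i)) =
      Aval L a * (2 ^ (M.card + N.card) * if Van M (b + c) ∧ Van N b then 1 else 0) := by
    have : ∀ t : Vec m × Vec m × Vec m, ∑ i, a i * t.1 i + ∑ i, b i * t.2.1 i +
      (∑ i, b i * t.2.2 i + ∑ i, c i * t.2.1 i) = ∑ i, a i * t.1 i +
      (∑ i, b i * t.2.2 i + ∑ i, (b + c) i * t.2.1 i) := by
      intro t
      simp only [Pi.add_apply, add_mul, Finset.sum_add_distrib]
      ring
    simp only [this]
    simp only [chi_add, Finset.sum_product, ← Finset.mul_sum, ← Finset.sum_mul, hA, chi_Δ]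
    by_cases h1 : Van M (b + c) <;> by_cases h2 : Van N b <;> simp [h1, h2, pow_add, mul_comm]
  rw [s1, s2, s3]
  unfold Sval
  ring

lemma Sval_three {m : ℕ} (M N : Finset (Fin m)) (b c : Vec m) :
    Sval M N b c = 3 ↔ Van (M ∪ N) b ∧ Van M c := by
  have h1 : Van (M ∪ N) b ↔ Van M b ∧ Van N b := by
    simp only [Van, Finset.mem_union]
    constructor
    · intro h
      exact ⟨fun i hi => h i (Or.inl hi), fun i hi => h i (Or.inr hi)⟩
    · rintro ⟨h, h'⟩ i (hi | hi)
      · exact h i hi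
      · exact h' i hi
  have h2 : Van M b → Van M c → Van M (b + c) := by
    intro h h' i hi
    simp [h i hi, h' i hi]
  rw [h1]
  unfold Sval
  by_cases p : Van M c <;> by_cases q : Van N b <;> by_cases r : Van M b <;>
    by_cases s : Van M (b + c) <;> simp_all

lemma Sval_cases {m : ℕ} (M N : Finset (Fin m)) (b c : Vec m) :
    Sval M N b c = 0 ∨ Sval M N b c = 1 ∨ Sval M N b c = 3 := by
  have h2 : Van M b → Van M c → Van M (b + c) := by
    intro h h' i hi
    simp [h i hi, h' i hi]
  have h3 : Van M b → Van M (b + c) → Van M c := by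
    intro h h' i hi
    simpa [h i hi] using h' i hi
  have h4 : Van M c → Van M (b + c) → Van M b := by
    intro h h' i hi
    simpa [h i hi] using h' i hi
  unfold Sval
  by_cases p : Van M c <;> by_cases q : Van N b <;> by_cases r : Van M b <;>
    by_cases s : Van M (b + c) <;> simp_all

lemma arith (a b : ℤ) (hb : 0 < b) (hab : b < a) (S : ℤ) (hS : S = 0 ∨ S = 1 ∨ S = 3)
    (z v : Prop) (hzv : z → v) (q : ℤ)
    (hq : q = 3 * (a - b) - ((if z then a else 0) - (if v then b else 0)) * S) :
    (q = 0 ↔ z ∧ S = 3) ∧ (q = 3 * a ↔ (v ∧ ¬ z) ∧ S = 3) ∧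
    (q = 3 * a - 2 * b ↔ (v ∧ ¬ z) ∧ S = 1) ∧ (q = 3 * (a - b) ↔ ¬ (v ∧ S ≠ 0)) ∧
    (q = 2 * (a - b) ↔ z ∧ S = 1) := by
  by_cases hz : z
  · have hv := hzv hz
    simp only [hz, hv, if_true] at hq
    rcases hS with rfl | rfl | rfl <;> simp [hz, hv] <;> omega
  · by_cases hv : v
    · simp only [hz, hv, if_true, if_false] at hq
      rcases hS with rfl | rfl | rfl <;> simp [hz, hv] <;> omega
    · simp only [hz, hv, if_false] at hq
      rcases hS with rfl | rfl | rfl <;> simp [hz, hv] <;> omega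

lemma card_transfer {m : ℕ} (Q : (Fin m → Rng) → Prop) :
    Nat.card {v | Q v} = (Finset.univ.filter (fun t => Q (E m t))).card := by
  rw [← Fintype.card_subtype, ← Nat.card_eq_fintype_card]
  exact (Nat.card_congr ((E m).subtypeEquiv (fun t => Iff.rfl))).symm

lemma card_prod_filter {α β : Type} [Fintype α] [Fintype β] (P : α → Prop) (Q : β → Prop)
    [DecidablePred P] [DecidablePred Q] [DecidablePred (fun t : α × β => P t.1 ∧ Q t.2)] :
    ((Finset.univ.filter (fun t : α × β => P t.1 ∧ Q t.2)).card : ℤ)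
      = (Finset.univ.filter P).card * (Finset.univ.filter Q).card := by
  rw [← Nat.cast_mul, ← Finset.card_product]
  congr 2
  ext t
  simp

lemma card_le_m {m : ℕ} (X : Finset (Fin m)) : X.card ≤ m := by
  simpa using Finset.card_le_univ X

lemma n3_card {m : ℕ} (M N : Finset (Fin m)) :
    ((Finset.univ.filter (fun t : Vec m × Vec m => Sval M N t.1 t.2 = 3)).card : ℤ)
      = 2 ^ (2 * m - M.card - (M ∪ N).card) := by
  simp only [Sval_three]
  rw [card_prod_filter, card_van, card_van]
  push_cast
  rw [← pow_add]
  congr 1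
  have := card_le_m M
  have := card_le_m (M ∪ N)
  omega

lemma S_sum {m : ℕ} (M N : Finset (Fin m)) :
    ∑ t : Vec m × Vec m, Sval M N t.1 t.2
      = 2 ^ (2 * m - M.card - N.card + 1) + 2 ^ (2 * m - M.card) := by
  have hM := card_le_m M
  have hN := card_le_m N
  have v1 : ∀ X : Finset (Fin m), ∑ a : Vec m, (if Van X a then (1:ℤ) else 0) = 2 ^ (m - X.card) := by
    intro X
    rw [← Finset.natCast_card_filter, card_van]
    push_cast; rfl
  unfold Sval
  simp only [Finset.sum_add_distrib, Fintype.sum_prod_type]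
  have s1 : ∑ b : Vec m, ∑ c : Vec m, (if Van M c ∧ Van N b then (1:ℤ) else 0)
      = 2 ^ (m - M.card) * 2 ^ (m - N.card) := by
    have : ∀ b c : Vec m, (if Van M c ∧ Van N b then (1:ℤ) else 0)
      = (if Van N b then 1 else 0) * (if Van M c then 1 else 0) := by
      intro b c
      by_cases h : Van M c <;> by_cases h' : Van N b <;> simp [h, h']
    simp only [this, ← Finset.mul_sum, ← Finset.sum_mul, v1]
    ring
  have s3 : ∑ b : Vec m, ∑ c : Vec m, (if Van M (b + c) ∧ Van N b then (1:ℤ) else 0)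
      = ∑ b : Vec m, ∑ c : Vec m, (if Van M c ∧ Van N b then (1:ℤ) else 0) := by
    refine Finset.sum_congr rfl fun b _ => ?_
    exact Equiv.sum_comp (Equiv.addLeft b) (fun c => if Van M c ∧ Van N b then (1:ℤ) else 0)
  have s2 : ∑ b : Vec m, ∑ _c : Vec m, (if Van M b then (1:ℤ) else 0)
      = 2 ^ m * 2 ^ (m - M.card) := by
    simp only [Finset.sum_const, nsmul_eq_mul, ← Finset.mul_sum, v1]
    simp [ZMod.card]
  rw [s3, s1, s2, ← pow_add, ← pow_add, show 2 * m - M.card - N.card + 1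
    = (m - M.card + (m - N.card)) + 1 by omega, show 2 * m - M.card = m + (m - M.card) by omega]
  ring

lemma n1_card {m : ℕ} (M N : Finset (Fin m)) :
    ((Finset.univ.filter (fun t : Vec m × Vec m => Sval M N t.1 t.2 = 1)).card : ℤ)
      = 2 ^ (2 * m - M.card - N.card + 1) + 2 ^ (2 * m - M.card)
        - 3 * 2 ^ (2 * m - M.card - (M ∪ N).card) := by
  rw [← S_sum, ← n3_card, Finset.natCast_card_filter, Finset.natCast_card_filter, Finset.mul_sum,
    ← Finset.sum_sub_distrib]
  refine Finset.sum_congr rfl fun t _ => ?_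
  rcases Sval_cases M N t.1 t.2 with h | h | h <;> simp [h]

lemma n13_card {m : ℕ} (M N : Finset (Fin m))
    [DecidablePred (fun t : Vec m × Vec m => Sval M N t.1 t.2 ≠ 0)] :
    ((Finset.univ.filter (fun t : Vec m × Vec m => Sval M N t.1 t.2 ≠ 0)).card : ℤ)
      = 2 ^ (2 * m - M.card - N.card + 1) + 2 ^ (2 * m - M.card)
        - 2 * 2 ^ (2 * m - M.card - (M ∪ N).card) := by
  have h : ((Finset.univ.filter (fun t : Vec m × Vec m => Sval M N t.1 t.2 ≠ 0)).card : ℤ)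
      = (Finset.univ.filter (fun t : Vec m × Vec m => Sval M N t.1 t.2 = 1)).card
       + (Finset.univ.filter (fun t : Vec m × Vec m => Sval M N t.1 t.2 = 3)).card := by
    rw [Finset.natCast_card_filter, Finset.natCast_card_filter, Finset.natCast_card_filter,
      ← Finset.sum_add_distrib]
    refine Finset.sum_congr rfl fun t _ => ?_
    rcases Sval_cases M N t.1 t.2 with h | h | h <;> simp [h]
  rw [h, n1_card, n3_card]
  ring

lemma card_zero {m : ℕ} : ((Finset.univ.filter (fun a : Vec m => a = 0)).card : ℤ) = 1 := by
  rw [Finset.filter_eq' Finset.univ (0 : Vec m)]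
  simp

lemma card_van_ne {m : ℕ} (L : Finset (Fin m)) :
    ((Finset.univ.filter (fun a : Vec m => Van L a ∧ ¬ a = 0)).card : ℤ)
      = 2 ^ (m - L.card) - 1 := by
  have h := card_van L
  have h1 := card_zero (m := m)
  have : ((Finset.univ.filter (fun a : Vec m => Van L a)).card : ℤ) = 2 ^ (m - L.card) := by
    rw [h]; push_cast; rfl
  rw [← this, ← h1]
  rw [Finset.natCast_card_filter, Finset.natCast_card_filter, Finset.natCast_card_filter,
      ← Finset.sum_sub_distrib]
  refine Finset.sum_congr rfl fun a _ => ?_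
  by_cases ha : a = 0
  · subst ha
    simp [Van]
  · simp [ha]

lemma Phi_zero_iff (r : Rng) : (∀ j, Phi r j = 0) ↔ r = 0 := by
  obtain ⟨a, b, c, rfl⟩ := emb_surj r
  rw [Phi_emb]
  constructor
  · intro h
    have h0 : a + c = 0 := h 0
    have h1 : a + b = 0 := h 1
    have h2 : a + b + c = 0 := h 2
    have hc : c = 0 := by simpa [h1] using h2
    have ha : a = 0 := by simpa [hc] using h0
    have hb : b = 0 := by simpa [ha] using h1
    rw [ha, hb, hc, emb_zero]
  · intro h
    obtain ⟨rfl, rfl, rfl⟩ := emb_inj (h.trans emb_zero.symm)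
    intro j
    fin_cases j <;> simp

lemma wtL_zero_iff {ι : Type} [Fintype ι] (x : ι → Rng) : wtL x = 0 ↔ x = 0 := by
  unfold wtL
  rw [Finset.sum_eq_zero_iff, funext_iff]
  refine forall_congr' fun i => ?_
  rw [Pi.zero_apply, ← Phi_zero_iff, Finset.card_eq_zero, Finset.filter_eq_empty_iff]
  simp

/-- The encoding map as a homomorphism. -/
def cDHom {m : ℕ} (D : Finset (Fin m → Rng)) : (Fin m → Rng) →+ (D → Rng) where
  toFun := cD D
  map_zero' := by
    funext d; simp [cD]
  map_add' := by
    intro x y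
    funext d
    simp [cD, add_mul, Finset.sum_add_distrib]

lemma card_range_mul {m : ℕ} (D : Finset (Fin m → Rng)) :
    Nat.card {v : Fin m → Rng | (wtL (cD D v) : ℚ) = 0} * Nat.card (Set.range (cD D))
      = 2 ^ (3 * m) := by
  have h1 := (cDHom D).ker.card_mul_index
  rw [AddSubgroup.index_ker] at h1
  have h2 : Nat.card (Fin m → Rng) = 2 ^ (3 * m) := by
    rw [← Nat.card_congr (E m)]
    simp [ZMod.card]
    ring
  have h3 : {v : Fin m → Rng | (wtL (cD D v) : ℚ) = 0} = ((cDHom D).ker : Set (Fin m → Rng)) := by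
    ext v
    simp only [Set.mem_ofPred_eq, SetLike.mem_coe, AddMonoidHom.mem_ker, Nat.cast_eq_zero,
      wtL_zero_iff]
    rfl
  rw [h3, ← h2, ← h1]
  rfl
theorem lee_weight_distribution_LcMN (m : ℕ) (hm : 0 < m) (L M N : Finset (Fin m))
    (hL : L ≠ Finset.univ)
    (D : Finset (Fin m → Rng)) (hD : D = Dset ((Δ L)ᶜ) (Δ M) (Δ N)) :
    ((D.card : ℤ) = (2 ^ m - 2 ^ L.card) * 2 ^ (M.card + N.card)) ∧
    Nat.card (Set.range (cD D)) = 2 ^ (m + M.card + (M ∪ N).card) ∧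
    (∀ v : Fin m → Rng,
      (wtL (cD D v) : ℚ) = 0 ∨
      (wtL (cD D v) : ℚ) = 3 * 2 ^ ((m : ℤ) + M.card + N.card - 1) ∨
      (wtL (cD D v) : ℚ) =
        2 ^ ((M.card : ℤ) + N.card - 1) * (3 * 2 ^ (m : ℤ) - 2 ^ ((L.card : ℤ) + 1)) ∨
      (wtL (cD D v) : ℚ) =
        3 * (2 ^ (m : ℤ) - 2 ^ (L.card : ℤ)) * 2 ^ ((M.card : ℤ) + N.card - 1) ∨
      (wtL (cD D v) : ℚ) =
        (2 ^ (m : ℤ) - 2 ^ (L.card : ℤ)) * 2 ^ ((M.card : ℤ) + N.card)) ∧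
    ((Nat.card {v : Fin m → Rng | (wtL (cD D v) : ℚ) = 0} : ℤ) =
      2 ^ (2 * m - M.card - (M ∪ N).card)) ∧
    ((Nat.card {v : Fin m → Rng |
        (wtL (cD D v) : ℚ) = 3 * 2 ^ ((m : ℤ) + M.card + N.card - 1)} : ℤ) =
      (2 ^ (m - L.card) - 1) * 2 ^ (2 * m - M.card - (M ∪ N).card)) ∧
    ((Nat.card {v : Fin m → Rng |
        (wtL (cD D v) : ℚ) =
          2 ^ ((M.card : ℤ) + N.card - 1) * (3 * 2 ^ (m : ℤ) - 2 ^ ((L.card : ℤ) + 1))} : ℤ) =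
      (2 ^ (m - L.card) - 1) *
        (2 ^ (2 * m - M.card - N.card + 1) + 2 ^ (2 * m - M.card)
          - 3 * 2 ^ (2 * m - M.card - (M ∪ N).card))) ∧
    ((Nat.card {v : Fin m → Rng |
        (wtL (cD D v) : ℚ) =
          3 * (2 ^ (m : ℤ) - 2 ^ (L.card : ℤ)) * 2 ^ ((M.card : ℤ) + N.card - 1)} : ℤ) =
      2 ^ (3 * m) - 2 ^ (3 * m - L.card - M.card) - 2 ^ (3 * m - L.card - M.card - N.card + 1)
        + 2 ^ (3 * m - L.card - M.card - (M ∪ N).card + 1)) ∧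
    ((Nat.card {v : Fin m → Rng |
        (wtL (cD D v) : ℚ) =
          (2 ^ (m : ℤ) - 2 ^ (L.card : ℤ)) * 2 ^ ((M.card : ℤ) + N.card)} : ℤ) =
      2 ^ (2 * m - M.card - N.card + 1) + 2 ^ (2 * m - M.card)
        - 3 * 2 ^ (2 * m - M.card - (M ∪ N).card)) := by
  subst hD
  have hlm : L.card < m := by
    have := Finset.card_lt_univ_of_notMem (s := L) (x := (Classical.choose
      (by by_contra h; push Not at h; exact hL (Finset.eq_univ_of_forall h) : ∃ x, x ∉ L)))
      (Classical.choose_spec (by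
        by_contra h; push Not at h; exact hL (Finset.eq_univ_of_forall h) : ∃ x, x ∉ L))
    simpa using this
  have hM := card_le_m M
  have hN := card_le_m N
  have hMN := card_le_m (M ∪ N)
  have hb : (0 : ℤ) < 2 ^ L.card := by positivity
  have hab : (2 : ℤ) ^ L.card < 2 ^ m := pow_lt_pow_right₀ (by norm_num) hlm
  set D := Dset ((Δ L)ᶜ) (Δ M) (Δ N) with hD
  -- normalised weight
  let q : Vec m × Vec m × Vec m → ℤ := fun x =>
    3 * (2 ^ m - 2 ^ L.card) - Aval L x.1 * Sval M N x.2.1 x.2.2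
  have hwt : ∀ x, (wtL (cD D (E m x)) : ℚ) = 2 ^ (M.card + N.card) / 2 * (q x : ℚ) := by
    intro x
    have h := wt_formula L M N x
    have h' : (2 : ℚ) * (wtL (cD D (E m x)) : ℚ) = 2 ^ (M.card + N.card) * (q x : ℚ) := by
      have h2 : 2 * (wtL (cD D (E m x)) : ℤ) = 2 ^ (M.card + N.card) * q x := h
      exact_mod_cast h2
    linarith
  have hiff : ∀ (w : ℚ) (c : ℤ), w = 2 ^ (M.card + N.card) / 2 * (c : ℚ) →
      ∀ x, (wtL (cD D (E m x)) : ℚ) = w ↔ q x = c := by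
    intro w c hw x
    rw [hwt, hw]
    have : (2 : ℚ) ^ (M.card + N.card) / 2 ≠ 0 := by positivity
    rw [mul_right_inj' this]
    exact_mod_cast Iff.rfl
  have har : ∀ x, _ := fun x => arith (2 ^ m) (2 ^ L.card) hb hab (Sval M N x.2.1 x.2.2)
    (Sval_cases M N x.2.1 x.2.2) (x.1 = 0) (Van L x.1)
    (fun h => by rw [h]; intro i _; rfl) (q x) (by simp only [q, Aval]; congr!)
  have two0 : (2 : ℚ) ≠ 0 := by norm_num
  have w0 := hiff 0 0 (by simp)
  have w1 := hiff (3 * 2 ^ ((m : ℤ) + M.card + N.card - 1)) (3 * 2 ^ m) (by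
    rw [zpow_sub₀ two0, zpow_add₀ two0, zpow_add₀ two0]
    push_cast [zpow_natCast, pow_add]; ring)
  have w2 := hiff (2 ^ ((M.card : ℤ) + N.card - 1) * (3 * 2 ^ (m : ℤ) - 2 ^ ((L.card : ℤ) + 1)))
    (3 * 2 ^ m - 2 * 2 ^ L.card) (by
    rw [zpow_sub₀ two0, zpow_add₀ two0, zpow_add₀ two0]
    push_cast [zpow_natCast, pow_add]; ring)
  have w3 := hiff (3 * (2 ^ (m : ℤ) - 2 ^ (L.card : ℤ)) * 2 ^ ((M.card : ℤ) + N.card - 1))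
    (3 * (2 ^ m - 2 ^ L.card)) (by
    rw [zpow_sub₀ two0, zpow_add₀ two0]
    push_cast [zpow_natCast, pow_add]; ring)
  have w4 := hiff ((2 ^ (m : ℤ) - 2 ^ (L.card : ℤ)) * 2 ^ ((M.card : ℤ) + N.card))
    (2 * (2 ^ m - 2 ^ L.card)) (by
    rw [zpow_add₀ two0]
    push_cast [zpow_natCast, pow_add]; ring)
  have c0 : ((Nat.card {v : Fin m → Rng | (wtL (cD D v) : ℚ) = 0} : ℤ) =
      2 ^ (2 * m - M.card - (M ∪ N).card)) := by
    rw [card_transfer]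
    simp only [w0, (har _).1]
    rw [card_prod_filter (fun a : Vec m => a = 0)
      (fun t : Vec m × Vec m => Sval M N t.1 t.2 = 3), card_zero, n3_card, one_mul]
  refine ⟨card_D L M N, ?_, ?_, c0, ?_, ?_, ?_, ?_⟩
  · have h := card_range_mul D
    have c0' : Nat.card {v : Fin m → Rng | (wtL (cD D v) : ℚ) = 0} =
      2 ^ (2 * m - M.card - (M ∪ N).card) := by exact_mod_cast c0
    rw [c0'] at h
    have hpos : 0 < 2 ^ (2 * m - M.card - (M ∪ N).card) := by positivity
    apply Nat.eq_of_mul_eq_mul_left hpos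
    rw [h, ← pow_add]
    congr 1
    omega
  · intro v
    obtain ⟨x, rfl⟩ := (E m).surjective v
    rw [w0, w1, w2, w3, w4, (har x).1, (har x).2.1, (har x).2.2.1, (har x).2.2.2.1,
      (har x).2.2.2.2]
    have hS := Sval_cases M N x.2.1 x.2.2
    by_cases hz : x.1 = 0 <;> by_cases hv : Van L x.1 <;> rcases hS with h | h | h <;>
      simp [hz, hv, h]
    all_goals exact absurd (fun i _ => by rw [hz]; rfl) hv
  · rw [card_transfer]
    simp only [w1, (har _).2.1]
    rw [card_prod_filter (fun a : Vec m => Van L a ∧ ¬ a = 0)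
      (fun t : Vec m × Vec m => Sval M N t.1 t.2 = 3), card_van_ne, n3_card]
  · rw [card_transfer]
    simp only [w2, (har _).2.2.1]
    rw [card_prod_filter (fun a : Vec m => Van L a ∧ ¬ a = 0)
      (fun t : Vec m × Vec m => Sval M N t.1 t.2 = 1), card_van_ne, n1_card]
  · rw [card_transfer]
    simp only [w3, (har _).2.2.2.1]
    have hc := card_prod_filter (fun a : Vec m => Van L a)
      (fun t : Vec m × Vec m => Sval M N t.1 t.2 ≠ 0)
    rw [card_van, n13_card] at hc
    have ht := Finset.card_filter_add_card_filter_not (s := Finset.univ)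
      (fun t : Vec m × Vec m × Vec m => Van L t.1 ∧ Sval M N t.2.1 t.2.2 ≠ 0)
    have hu : (Finset.univ : Finset (Vec m × Vec m × Vec m)).card = 2 ^ (3 * m) := by
      simp [ZMod.card]
      ring
    rw [hu] at ht
    have ht' := congrArg (Nat.cast : ℕ → ℤ) ht
    push_cast at ht' hc
    rw [hc] at ht'
    rw [show 3 * m - L.card - M.card = (m - L.card) + (2 * m - M.card) by omega,
      show (m - L.card) + (2 * m - M.card) - N.card + 1
        = (m - L.card) + (2 * m - M.card - N.card + 1) by omega,
      show (m - L.card) + (2 * m - M.card) - (M ∪ N).card + 1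
        = (m - L.card) + (2 * m - M.card - (M ∪ N).card) + 1 by omega,
      pow_succ _ ((m - L.card) + (2 * m - M.card - (M ∪ N).card)), pow_add _ (m - L.card) (2 * m - M.card),
      pow_add _ (m - L.card) (2 * m - M.card - N.card + 1),
      pow_add _ (m - L.card) (2 * m - M.card - (M ∪ N).card)]
    refine Eq.trans ?_ ((eq_sub_of_add_eq' ht').trans ?_)
    · congr!
    · ring
  · rw [card_transfer]
    simp only [w4, (har _).2.2.2.2]
    rw [card_prod_filter (fun a : Vec m => a = 0)
      (fun t : Vec m × Vec m => Sval M N t.1 t.2 = 1), card_zero, n1_card, one_mul]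

end
end
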